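/- Let ψ, φ : ℝ → ℂ be Schwartz functions, ε_n := 2^{-(n^n)}, a_m := ε_{6m−1}^{−1}, F(ξ) := Σ_{m=1}^∞ ψ(ξ − a_m), and for ε ∈ (0,1] define u_ε(x) := ∫_ℝ F(ξ)·(𝓕φ)(εξ)·e^{2πixξ} dξ (the integrand is integrable since F is bounded and 𝓕φ is Schwartz). Then u_ε is smooth, and for every k ∈ ℕ there exist a constant C and N ∈ ℕ such that for all n ≥ N, all ε ∈ (ε_{6n+3}, ε_{6n}], and all x ∈ ℝ, |u_ε^{(k)}(x)| ≤ C·ε^{−1}. -/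

import Mathlib

open MeasureTheory
open scoped FourierTransform Real

/-- The scale `ε_n = 2^{-(n^n)}`. -/
noncomputable def eps (n : ℕ) : ℝ := ((2 : ℝ) ^ (n ^ n))⁻¹

/-- The translation points `a_m = ε_{6m-1}⁻¹ = 2^{((6m-1)^{6m-1})}`. -/
noncomputable def a (m : ℕ) : ℝ := (eps (6 * m - 1))⁻¹

/-- The sum `F(ξ) = Σ_{m=1}^∞ ψ(ξ − a_m)`. -/
noncomputable def F (ψ : SchwartzMap ℝ ℂ) (ξ : ℝ) : ℂ := ∑' m : ℕ, ψ (ξ - a (m + 1))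

/-- The representative `u_ε(x) = ∫ F(ξ)·(𝓕φ)(εξ)·e^{2πixξ} dξ` of the embedded
distribution of the counterexample. -/
noncomputable def u (ψ φ : SchwartzMap ℝ ℂ) (ε : ℝ) (x : ℝ) : ℂ :=
  ∫ ξ : ℝ, F ψ ξ * 𝓕 (⇑φ) (ε * ξ) * Complex.exp (2 * (π : ℂ) * Complex.I * (x : ℂ) * (ξ : ℂ))

theorem a_eq (m : ℕ) : a m = 2 ^ ((6 * m - 1) ^ (6 * m - 1)) := by
  simp [a, eps]

theorem a_pos (m : ℕ) : 0 < a m := by rw [a_eq]; positivity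

theorem one_le_a (m : ℕ) : 1 ≤ a m := by
  rw [a_eq]; exact one_le_pow₀ (by norm_num)

theorem a_mono {m n : ℕ} (hm : 1 ≤ m) (h : m ≤ n) : a m ≤ a n := by
  rw [a_eq, a_eq]
  refine pow_le_pow_right₀ (by norm_num) ?_
  exact (Nat.pow_le_pow_left (by omega) _).trans (Nat.pow_le_pow_right (by omega) (by omega))

theorem two_pow_le_a (m : ℕ) : 2 ^ m ≤ a (m + 1) := by
  rw [a_eq]
  refine pow_le_pow_right₀ (by norm_num) ?_
  exact (show m ≤ 6 * (m + 1) - 1 by omega).trans (Nat.le_self_pow (by omega) _)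

theorem eps_pos (n : ℕ) : 0 < eps n := by unfold eps; positivity

theorem eps_le_one (n : ℕ) : eps n ≤ 1 :=
  inv_le_one_of_one_le₀ (one_le_pow₀ (by norm_num))

/-- Polynomially weighted decay of a Schwartz function. -/
theorem SchwartzMap.exists_one_add_abs_pow_mul_norm_le (f : SchwartzMap ℝ ℂ) (p : ℕ) :
    ∃ B : ℝ, 0 ≤ B ∧ ∀ t : ℝ, (1 + |t|) ^ p * ‖f t‖ ≤ B := by
  refine ⟨_, ?_, fun t ↦ by
    simpa using! SchwartzMap.one_add_le_sup_seminorm_apply (𝕜 := ℝ) (m := (p, 0)) le_rfl le_rfl f t⟩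
  positivity

/-- The pointwise bound for one translate: for small indices the factor `w` is merely bounded, for
large indices its decay is used. -/
theorem abs_pow_mul_norm_mul_norm_le {k : ℕ} {f w : ℝ → ℂ} {B D : ℝ}
    (hf : ∀ t, (1 + |t|) ^ (k + 4) * ‖f t‖ ≤ B) (hw : ∀ t, (1 + |t|) ^ (k + 2) * ‖w t‖ ≤ D)
    {ε : ℝ} (hε : 0 < ε) (hε1 : ε ≤ 1) (n m : ℕ) (ξ : ℝ) :
    |ξ| ^ k * (‖f (ξ - a (m + 1))‖ * ‖w (ε * ξ)‖) ≤
      D * B * (a n ^ k * 2 ^ n + (ε⁻¹) ^ (k + 2) / a (n + 1)) * (1 / 2) ^ m *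
        (1 + (ξ - a (m + 1)) ^ 2)⁻¹ := by
  set b := a (m + 1)
  set y := ξ - b
  have hb1 : 1 ≤ b := one_le_a _
  have hB : 0 ≤ B := le_trans (by positivity) (hf 0)
  have hD : 0 ≤ D := le_trans (by positivity) (hw 0)
  have han := a_pos n
  have han1 := a_pos (n + 1)
  have hξy : |ξ| ≤ b + |y| := by
    have : ξ = b + y := by ring
    calc |ξ| = |b + y| := by rw [← this]
      _ ≤ |b| + |y| := abs_add_le _ _
      _ = b + |y| := by rw [abs_of_pos (by linarith)]
  have hby : b ≤ |ξ| + |y| := by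
    have := abs_sub ξ y
    have h2 : ξ - y = b := by ring
    rw [h2] at this
    exact (le_abs_self b).trans this
  have hyy : (1 + |y|) ^ (k + 2) * ‖f y‖ ≤ B * (1 + y ^ 2)⁻¹ := by
    rw [← div_eq_mul_inv, le_div_iff₀ (by positivity)]
    refine le_trans ?_ (hf y)
    have : 1 + y ^ 2 ≤ (1 + |y|) ^ 2 := by nlinarith [sq_abs y, abs_nonneg y]
    calc _ ≤ (1 + |y|) ^ (k + 2) * ‖f y‖ * (1 + |y|) ^ 2 := by gcongr
      _ = _ := by ring
  suffices h : |ξ| ^ k * ‖w (ε * ξ)‖ ≤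
      D * (a n ^ k * 2 ^ n + (ε⁻¹) ^ (k + 2) / a (n + 1)) * (1 / 2) ^ m * (1 + |y|) ^ (k + 2) by
    calc _ = (|ξ| ^ k * ‖w (ε * ξ)‖) * ‖f y‖ := by ring
      _ ≤ (D * (a n ^ k * 2 ^ n + (ε⁻¹) ^ (k + 2) / a (n + 1)) * (1 / 2) ^ m *
            (1 + |y|) ^ (k + 2)) * ‖f y‖ := by gcongr
      _ = D * (a n ^ k * 2 ^ n + (ε⁻¹) ^ (k + 2) / a (n + 1)) * (1 / 2) ^ m *
            ((1 + |y|) ^ (k + 2) * ‖f y‖) := by ring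
      _ ≤ D * (a n ^ k * 2 ^ n + (ε⁻¹) ^ (k + 2) / a (n + 1)) * (1 / 2) ^ m *
            (B * (1 + y ^ 2)⁻¹) := by gcongr
      _ = _ := by ring
  rcases lt_or_ge m n with hmn | hmn
  · have hwD : ‖w (ε * ξ)‖ ≤ D := by
      refine le_trans ?_ (hw (ε * ξ))
      exact le_mul_of_one_le_left (norm_nonneg _)
        (one_le_pow₀ (by linarith [abs_nonneg (ε * ξ)]))
    have hban : b ≤ a n := a_mono (by omega) (by omega)
    have h1 : |ξ| ^ k ≤ a n ^ k * (1 + |y|) ^ (k + 2) := by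
      calc |ξ| ^ k ≤ (a n * (1 + |y|)) ^ k := by
            gcongr
            nlinarith [abs_nonneg y]
        _ = a n ^ k * (1 + |y|) ^ k := mul_pow _ _ _
        _ ≤ _ := by
            gcongr
            · linarith [abs_nonneg y]
            · omega
    have h2 : (1 : ℝ) ≤ 2 ^ n * (1 / 2) ^ m := by
      rw [one_div, inv_pow, ← div_eq_mul_inv, one_le_div (by positivity)]
      exact pow_le_pow_right₀ (by norm_num) hmn.le
    calc _ ≤ (a n ^ k * (1 + |y|) ^ (k + 2)) * D := by gcongr
      _ ≤ (a n ^ k * (1 + |y|) ^ (k + 2)) * D * (2 ^ n * (1 / 2) ^ m) :=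
          le_mul_of_one_le_right (by positivity) h2
      _ = D * (a n ^ k * 2 ^ n + 0) * (1 / 2) ^ m * (1 + |y|) ^ (k + 2) := by ring
      _ ≤ _ := by
          gcongr
          positivity
  · have h1 : (1 + |ξ|) ^ (k + 2) * ‖w (ε * ξ)‖ ≤ (ε⁻¹) ^ (k + 2) * D := by
      have : 1 + |ξ| ≤ ε⁻¹ * (1 + |ε * ξ|) := by
        rw [abs_mul, abs_of_pos hε, mul_add, inv_mul_cancel_left₀ hε.ne', mul_one]
        linarith [(one_le_inv₀ hε).2 hε1]
      calc _ ≤ (ε⁻¹ * (1 + |ε * ξ|)) ^ (k + 2) * ‖w (ε * ξ)‖ := by gcongr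
        _ = (ε⁻¹) ^ (k + 2) * ((1 + |ε * ξ|) ^ (k + 2) * ‖w (ε * ξ)‖) := by rw [mul_pow, mul_assoc]
        _ ≤ _ := by
          gcongr
          exact hw _
    have h2 : b ≤ (1 + |ξ|) * (1 + |y|) := by
      nlinarith [abs_nonneg ξ, abs_nonneg y, mul_nonneg (abs_nonneg ξ) (abs_nonneg y)]
    have h3 : a (n + 1) * 2 ^ m ≤ b ^ 2 := by
      rw [sq]
      exact mul_le_mul (a_mono (by omega) (by omega)) (two_pow_le_a m) (by positivity)
        (by linarith)
    have h4 : |ξ| ^ k * (a (n + 1) * 2 ^ m) ≤ (1 + |ξ|) ^ (k + 2) * (1 + |y|) ^ (k + 2) := by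
      calc _ ≤ (1 + |ξ|) ^ k * ((1 + |ξ|) * (1 + |y|)) ^ 2 := by
            gcongr
            · linarith
            · exact h3.trans (by gcongr)
        _ = (1 + |ξ|) ^ (k + 2) * (1 + |y|) ^ 2 := by ring
        _ ≤ _ := by
            gcongr
            · linarith [abs_nonneg y]
            · omega
    have h5 : |ξ| ^ k ≤ (1 + |ξ|) ^ (k + 2) * ((1 + |y|) ^ (k + 2) / a (n + 1) * (1 / 2) ^ m) := by
      rw [← le_div_iff₀ (by positivity)] at h4
      refine h4.trans_eq ?_
      rw [one_div, inv_pow]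
      field_simp
    calc _ ≤ ((1 + |ξ|) ^ (k + 2) * ((1 + |y|) ^ (k + 2) / a (n + 1) * (1 / 2) ^ m)) *
            ‖w (ε * ξ)‖ := by gcongr
      _ = ((1 + |ξ|) ^ (k + 2) * ‖w (ε * ξ)‖) *
            ((1 + |y|) ^ (k + 2) / a (n + 1) * (1 / 2) ^ m) := by ring
      _ ≤ ((ε⁻¹) ^ (k + 2) * D) * ((1 + |y|) ^ (k + 2) / a (n + 1) * (1 / 2) ^ m) := by gcongr
      _ = D * (0 + (ε⁻¹) ^ (k + 2) / a (n + 1)) * (1 / 2) ^ m * (1 + |y|) ^ (k + 2) := by ring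
      _ ≤ _ := by
          gcongr
          positivity

theorem measurable_F (ψ : SchwartzMap ℝ ℂ) : Measurable (F ψ) :=
  Measurable.tsum fun _ ↦ (ψ.continuous.comp (continuous_id.sub continuous_const)).measurable

theorem lintegral_inv_one_add_sub_sq (b : ℝ) :
    ∫⁻ ξ : ℝ, ENNReal.ofReal ((1 + (ξ - b) ^ 2)⁻¹) = ENNReal.ofReal π := by
  rw [lintegral_sub_right_eq_self (fun ξ : ℝ ↦ ENNReal.ofReal ((1 + ξ ^ 2)⁻¹)) b,
    ← ofReal_integral_eq_lintegral_ofReal integrable_inv_one_add_sq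
      (Filter.Eventually.of_forall fun x ↦ by positivity),
    integral_univ_inv_one_add_sq]

theorem exists_lintegral_pow_smul_le (ψ φ : SchwartzMap ℝ ℂ) (k : ℕ) :
    ∃ K : ℝ, 0 ≤ K ∧ ∀ ε : ℝ, 0 < ε → ε ≤ 1 → ∀ n : ℕ,
      ∫⁻ ξ : ℝ, ‖ξ ^ k • (F ψ ξ * 𝓕 (⇑φ) (ε * ξ))‖ₑ ≤
        ENNReal.ofReal (K * (a n ^ k * 2 ^ n + (ε⁻¹) ^ (k + 2) / a (n + 1))) := by
  obtain ⟨B, hB0, hB⟩ := ψ.exists_one_add_abs_pow_mul_norm_le (k + 4)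
  obtain ⟨D, hD0, hD⟩ := (𝓕 φ).exists_one_add_abs_pow_mul_norm_le (k + 2)
  refine ⟨D * B * 2 * π, by positivity, fun ε hε hε1 n ↦ ?_⟩
  rw [← SchwartzMap.fourier_coe]
  set A := a n ^ k * 2 ^ n + (ε⁻¹) ^ (k + 2) / a (n + 1)
  have hA0 : 0 ≤ A := by have := a_pos n; have := a_pos (n + 1); positivity
  have hpt (ξ : ℝ) : ‖ξ ^ k • (F ψ ξ * (𝓕 φ) (ε * ξ))‖ₑ ≤
      ∑' m : ℕ, ENNReal.ofReal (D * B * A * (1 / 2) ^ m) *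
        ENNReal.ofReal ((1 + (ξ - a (m + 1)) ^ 2)⁻¹) := by
    rw [enorm_smul, enorm_mul, F]
    calc _ ≤ ‖ξ ^ k‖ₑ * ((∑' m : ℕ, ‖ψ (ξ - a (m + 1))‖ₑ) * ‖(𝓕 φ) (ε * ξ)‖ₑ) := by
          gcongr
          exact enorm_tsum_le_tsum_enorm
      _ = ∑' m : ℕ, ‖ξ ^ k‖ₑ * (‖ψ (ξ - a (m + 1))‖ₑ * ‖(𝓕 φ) (ε * ξ)‖ₑ) := by
          rw [ENNReal.tsum_mul_left, ENNReal.tsum_mul_right]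
      _ ≤ _ := by
          refine ENNReal.tsum_le_tsum fun m ↦ ?_
          rw [← ofReal_norm, ← ofReal_norm, ← ofReal_norm, ← ENNReal.ofReal_mul (by positivity),
            ← ENNReal.ofReal_mul (by positivity), ← ENNReal.ofReal_mul (by positivity)]
          refine ENNReal.ofReal_le_ofReal ?_
          rw [norm_pow, Real.norm_eq_abs]
          exact abs_pow_mul_norm_mul_norm_le hB hD hε hε1 n m ξ
  have hsum : ∑' m : ℕ, ENNReal.ofReal ((1 / 2 : ℝ) ^ m) = ENNReal.ofReal 2 := by
    rw [← ENNReal.ofReal_tsum_of_nonneg (fun m ↦ by positivity) summable_geometric_two,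
      tsum_geometric_two]
  calc _ ≤ ∫⁻ ξ : ℝ, ∑' m : ℕ, ENNReal.ofReal (D * B * A * (1 / 2) ^ m) *
        ENNReal.ofReal ((1 + (ξ - a (m + 1)) ^ 2)⁻¹) := lintegral_mono hpt
    _ = ∑' m : ℕ, ENNReal.ofReal (D * B * A) * ENNReal.ofReal ((1 / 2) ^ m) *
          ENNReal.ofReal π := by
        rw [lintegral_tsum fun m ↦ by fun_prop]
        refine tsum_congr fun m ↦ ?_
        rw [lintegral_const_mul _ (by fun_prop), lintegral_inv_one_add_sub_sq,
          ENNReal.ofReal_mul (by positivity)]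
    _ = _ := by
        rw [ENNReal.tsum_mul_right, ENNReal.tsum_mul_left, hsum,
          ← ENNReal.ofReal_mul (by positivity), ← ENNReal.ofReal_mul (by positivity)]
        congr 1
        ring

theorem integrable_pow_smul (ψ φ : SchwartzMap ℝ ℂ) (k : ℕ) {ε : ℝ} (hε : 0 < ε) (hε1 : ε ≤ 1) :
    Integrable fun ξ : ℝ ↦ ξ ^ k • (F ψ ξ * 𝓕 (⇑φ) (ε * ξ)) := by
  obtain ⟨K, -, hK⟩ := exists_lintegral_pow_smul_le ψ φ k
  refine ⟨?_, (hK ε hε hε1 0).trans_lt ENNReal.ofReal_lt_top⟩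
  rw [← SchwartzMap.fourier_coe]
  have h1 := measurable_F ψ
  have h2 : Measurable fun ξ : ℝ ↦ (𝓕 φ) (ε * ξ) :=
    ((𝓕 φ).continuous.comp (continuous_const.mul continuous_id)).measurable
  exact ((measurable_id.pow_const k).smul (h1.mul h2)).aestronglyMeasurable

theorem u_eq_fourier (ψ φ : SchwartzMap ℝ ℂ) (ε : ℝ) :
    u ψ φ ε = fun x ↦ 𝓕 (fun ξ : ℝ ↦ F ψ ξ * 𝓕 (⇑φ) (ε * ξ)) (-x) := by
  ext x
  rw [Real.fourier_real_eq_integral_exp_smul, u]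
  refine integral_congr_ae (Filter.Eventually.of_forall fun ξ ↦ ?_)
  simp only [smul_eq_mul]
  rw [mul_comm]
  congr 2
  push_cast
  ring

theorem contDiff_u (ψ φ : SchwartzMap ℝ ℂ) {ε : ℝ} (hε : 0 < ε) (hε1 : ε ≤ 1) :
    ContDiff ℝ (⊤ : ℕ∞) (u ψ φ ε) := by
  rw [u_eq_fourier]
  refine (Real.contDiff_fourier (N := ⊤) fun n _ ↦ ?_).comp contDiff_neg
  simpa [norm_smul] using (integrable_pow_smul ψ φ n hε hε1).norm

theorem exists_norm_iteratedDeriv_u_le (ψ φ : SchwartzMap ℝ ℂ) (k : ℕ) :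
    ∃ K : ℝ, 0 ≤ K ∧ ∀ ε : ℝ, 0 < ε → ε ≤ 1 → ∀ (n : ℕ) (x : ℝ),
      ‖iteratedDeriv k (u ψ φ ε) x‖ ≤
        K * (a n ^ k * 2 ^ n + (ε⁻¹) ^ (k + 2) / a (n + 1)) := by
  obtain ⟨K, hK0, hK⟩ := exists_lintegral_pow_smul_le ψ φ k
  refine ⟨(2 * π) ^ k * K, by positivity, fun ε hε hε1 n x ↦ ?_⟩
  have := a_pos n
  have := a_pos (n + 1)
  rw [u_eq_fourier, iteratedDeriv_comp_neg, Real.iteratedDeriv_fourier (N := ⊤)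
    (fun j _ ↦ integrable_pow_smul ψ φ j hε hε1) le_top, norm_smul, norm_pow, norm_neg, norm_one,
    one_pow, one_mul]
  refine (VectorFourier.norm_fourierIntegral_le_integral_norm _ _ _ _ _).trans ?_
  have hnorm (ξ : ℝ) : ‖(-2 * π * Complex.I * ξ) ^ k • (F ψ ξ * 𝓕 (⇑φ) (ε * ξ))‖ =
      (2 * π) ^ k * ‖ξ ^ k • (F ψ ξ * 𝓕 (⇑φ) (ε * ξ))‖ := by
    simp only [norm_smul, norm_pow, norm_mul, norm_neg, Complex.norm_I, Complex.norm_real,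
      Complex.norm_ofNat, Real.norm_eq_abs, abs_of_pos Real.pi_pos, mul_one]
    ring
  simp_rw [hnorm]
  rw [integral_const_mul, mul_assoc]
  gcongr
  rw [integral_norm_eq_lintegral_enorm (integrable_pow_smul ψ φ k hε hε1).1]
  exact ENNReal.toReal_le_of_le_ofReal (by positivity) (hK ε hε hε1 n)

theorem a_pow_mul_two_pow_le {k n : ℕ} (hn : 1 ≤ n) (hk : k ≤ n) :
    a n ^ k * 2 ^ n ≤ (eps (6 * n))⁻¹ := by
  obtain ⟨q, hq⟩ : ∃ q, 6 * n = q + 1 := ⟨6 * n - 1, by omega⟩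
  rw [a_eq, eps, inv_inv, hq, Nat.add_sub_cancel, ← pow_mul, ← pow_add]
  refine pow_le_pow_right₀ (by norm_num) ?_
  have h1 : q ≤ q ^ q := Nat.le_self_pow (by omega) _
  have h2 : q ^ q ≤ (q + 1) ^ q := Nat.pow_le_pow_left (by omega) _
  calc q ^ q * k + n ≤ q ^ q * q + q ^ q := by gcongr <;> omega
    _ = q ^ q * (q + 1) := by ring
    _ ≤ (q + 1) ^ q * (q + 1) := by gcongr
    _ = (q + 1) ^ (q + 1) := by ring

theorem inv_eps_pow_le_a {k n : ℕ} (hk : k ≤ n) :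
    (eps (6 * n + 3))⁻¹ ^ (k + 1) ≤ a (n + 1) := by
  obtain ⟨q, hq⟩ : ∃ q, 6 * n + 3 = q := ⟨_, rfl⟩
  rw [a_eq, eps, inv_inv, show 6 * (n + 1) - 1 = q + 2 by omega, hq, ← pow_mul]
  refine pow_le_pow_right₀ (by norm_num) ?_
  calc q ^ q * (k + 1) ≤ (q + 2) ^ q * (q + 2) := by gcongr <;> omega
    _ = (q + 2) ^ (q + 1) := by ring
    _ ≤ _ := Nat.pow_le_pow_right (by omega) (by omega)

/-- Each `u_ε` (`ε ∈ (0,1]`) is smooth, and for every `k` there are `C` and `N` such that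
`|u_ε^{(k)}(x)| ≤ C·ε⁻¹` for all `n ≥ N`, `ε ∈ (ε_{6n+3}, ε_{6n}]`, `x ∈ ℝ`. -/
theorem stmt14 (ψ φ : SchwartzMap ℝ ℂ) :
    (∀ ε : ℝ, ε ∈ Set.Ioc (0 : ℝ) 1 → ContDiff ℝ (⊤ : ℕ∞) (u ψ φ ε)) ∧
    ∀ k : ℕ, ∃ C : ℝ, ∃ N : ℕ, ∀ n : ℕ, N ≤ n →
      ∀ ε : ℝ, eps (6 * n + 3) < ε → ε ≤ eps (6 * n) →
        ∀ x : ℝ, ‖iteratedDeriv k (u ψ φ ε) x‖ ≤ C * ε⁻¹ := by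
  refine ⟨fun ε hε ↦ contDiff_u ψ φ hε.1 hε.2, fun k ↦ ?_⟩
  obtain ⟨K, hK0, hK⟩ := exists_norm_iteratedDeriv_u_le ψ φ k
  refine ⟨K * 2, k + 1, fun n hn ε hlo hhi x ↦ ?_⟩
  have hε : 0 < ε := (eps_pos _).trans hlo
  refine (hK ε hε (hhi.trans (eps_le_one _)) n x).trans ?_
  rw [mul_assoc]
  gcongr
  have h1 : a n ^ k * 2 ^ n ≤ ε⁻¹ :=
    (a_pow_mul_two_pow_le (by omega) (by omega)).trans (inv_anti₀ hε hhi)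
  have h2 : (ε⁻¹) ^ (k + 2) / a (n + 1) ≤ ε⁻¹ := by
    rw [div_le_iff₀ (a_pos _), pow_succ' _ (k + 1)]
    gcongr
    refine le_trans ?_ (inv_eps_pow_le_a (show k ≤ n by omega))
    have := eps_pos (6 * n + 3)
    gcongr
  linarith
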